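/- arXiv:1801.04643 — 2 statements merged into one kernel-verified Lean document; each statement's English description precedes it below -/
import Mathlib

section
/- For |q|<1, the identity Σ_{n∈ℤ} (-1)^n q^{3n²+3n}/(1+q^{3n+1}) + Σ_{n∈ℤ} (-1)^n q^{3n²+3n}/(1-q^{3n+1}) = 2·(q^6;q^6)_∞³/(q^2;q^2)_∞ holds. -/
open scoped BigOperators

noncomputable def poch (a q : ℂ) : ℂ := ∏' n : ℕ, (1 - a * q ^ n)

noncomputable def Jm (m : ℕ) (q : ℂ) : ℂ := poch (q ^ m) (q ^ m)

noncomputable def Jam (a m : ℕ) (q : ℂ) : ℂ :=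
  poch (q ^ a) (q ^ m) * poch (q ^ (m - a)) (q ^ m) * poch (q ^ m) (q ^ m)

noncomputable def Sser (a Q : ℂ) : ℂ :=
  ∑' n : ℕ, (1 / (1 - a * Q ^ n) - 1 / (1 - a⁻¹ * Q ^ (n + 1)))

open Filter Topology

/-- The reciprocal `1 / (x; x)_k`, extended by zero to negative `k`. -/
noncomputable def recipPoch (x : ℂ) (k : ℤ) : ℂ :=
  if k < 0 then 0 else (∏ j ∈ Finset.range k.toNat, (1 - x ^ (j + 1)))⁻¹

lemma recipPoch_of_neg (x : ℂ) {k : ℤ} (hk : k < 0) : recipPoch x k = 0 := if_pos hk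

lemma recipPoch_natCast (x : ℂ) (k : ℕ) :
    recipPoch x k = (∏ j ∈ Finset.range k, (1 - x ^ (j + 1)))⁻¹ := by
  simp [recipPoch]

lemma recipPoch_sub_one {x : ℂ} (hx : ∀ j : ℕ, x ^ (j + 1) ≠ 1) (k : ℤ) :
    recipPoch x (k - 1) = (1 - x ^ k) * recipPoch x k := by
  rcases lt_trichotomy k 0 with hk | rfl | hk
  · rw [recipPoch_of_neg x hk, recipPoch_of_neg x (by lia), mul_zero]
  · rw [recipPoch_of_neg x (by lia)]
    simp
  · obtain ⟨m, rfl⟩ : ∃ m : ℕ, k = (m + 1 : ℕ) := ⟨(k - 1).toNat, by lia⟩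
    have h1 : ((m + 1 : ℕ) : ℤ) - 1 = (m : ℕ) := by lia
    rw [h1, recipPoch_natCast, recipPoch_natCast, Finset.prod_range_succ, mul_inv, zpow_natCast]
    have h2 : 1 - x ^ (m + 1) ≠ 0 := sub_ne_zero.2 (hx m).symm
    field_simp

/-- The coefficient of `1 / (1 - z p ^ (2 n))` in the partial fraction expansion of the reciprocal
of the truncated theta product. -/
noncomputable def thetaCoeff (p : ℂ) (N n : ℤ) : ℂ :=
  (-1) ^ n * p ^ (n ^ 2 + n) * recipPoch (p ^ 2) (N - n) * recipPoch (p ^ 2) (N + n)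

lemma thetaCoeff_eq_zero (p : ℂ) {N n : ℤ} (hn : n ∉ Set.Icc (-N) N) : thetaCoeff p N n = 0 := by
  rw [Set.mem_Icc, not_and_or, not_le, not_le] at hn
  rcases hn with hn | hn
  · rw [thetaCoeff, recipPoch_of_neg _ (show N + n < 0 by lia), mul_zero]
  · rw [thetaCoeff, recipPoch_of_neg _ (show N - n < 0 by lia), mul_zero, zero_mul]

lemma summable_thetaCoeff_mul (p : ℂ) (N : ℤ) (f : ℤ → ℂ) :
    Summable fun n ↦ thetaCoeff p N n * f n := by
  refine summable_of_hasFiniteSupport ((Set.finite_Icc (-N) N).subset fun n hn ↦ ?_)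
  by_contra h
  exact hn (by simp [thetaCoeff_eq_zero p h])

lemma thetaCoeff_neg {p : ℂ} (hp : p ≠ 0) (N n : ℤ) :
    thetaCoeff p N (-n) = thetaCoeff p N n * p ^ (-2 * n) := by
  have h : p ^ ((-n) ^ 2 + -n) = p ^ (n ^ 2 + n) * p ^ (-2 * n) := by
    rw [← zpow_add₀ hp]; congr 1; ring
  have h' : (-1 : ℂ) ^ (-n) = (-1) ^ n := by rw [zpow_neg, ← inv_zpow, inv_neg_one]
  rw [thetaCoeff, thetaCoeff, h, h', sub_neg_eq_add, ← sub_eq_add_neg]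
  ring

lemma tsum_thetaCoeff_mul_zpow {p : ℂ} (hp : p ≠ 0) (N : ℤ) :
    ∑' n, thetaCoeff p N n * p ^ (-2 * n) = ∑' n, thetaCoeff p N n := by
  rw [← (Equiv.neg ℤ).tsum_eq (thetaCoeff p N)]
  exact tsum_congr fun n ↦ (thetaCoeff_neg hp N n).symm

lemma tsum_thetaCoeff {p : ℂ} (hp : p ≠ 0) (hp1 : ∀ j : ℕ, (p ^ 2) ^ (j + 1) ≠ 1) (N : ℕ) :
    ∑' n, thetaCoeff p (N + 1) n = 0 := by
  set M : ℤ := N + 1 with hM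
  let U : ℤ → ℂ := fun n ↦
    (-1) ^ n * p ^ (n ^ 2 - n) * recipPoch (p ^ 2) (M - n) * recipPoch (p ^ 2) (M + n - 1)
  have hU : ∑' n, U n = 0 := by
    have h : ∑' n, U n = ∑' n, -U n := by
      rw [← (Equiv.subLeft (1 : ℤ)).tsum_eq U]
      refine tsum_congr fun n ↦ ?_
      have h1 : (-1 : ℂ) ^ (1 - n) = -(-1) ^ n := by
        rw [zpow_sub₀ (by simp), zpow_one, div_eq_mul_inv, ← inv_zpow, inv_neg_one]; ring
      have h2 : (1 - n) ^ 2 - (1 - n) = n ^ 2 - n := by ring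
      have h3 : M - (1 - n) = M + n - 1 := by ring
      have h4 : M + (1 - n) - 1 = M - n := by ring
      simp only [U, Equiv.subLeft_apply, h1, h2, h3, h4]
      ring
    rw [tsum_neg] at h
    exact self_eq_neg.1 h
  have hUT (n : ℤ) : U n = thetaCoeff p M n * p ^ (-2 * n) - thetaCoeff p M n * p ^ (2 * M) := by
    have h1 : p ^ (n ^ 2 - n) = p ^ (n ^ 2 + n) * p ^ (-2 * n) := by
      rw [← zpow_add₀ hp]; congr 1; ring
    have h2 : p ^ (-2 * n) * (p ^ 2) ^ (M + n) = p ^ (2 * M) := by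
      rw [← zpow_natCast p 2, ← zpow_mul, ← zpow_add₀ hp]; congr 1; push_cast; ring
    simp only [U, thetaCoeff, h1, recipPoch_sub_one hp1, ← h2]
    ring
  have key : (1 - p ^ (2 * M)) * ∑' n, thetaCoeff p M n = 0 := by
    rw [← hU, tsum_congr hUT, (summable_thetaCoeff_mul p M _).tsum_sub
      (summable_thetaCoeff_mul p M _), tsum_thetaCoeff_mul_zpow hp, tsum_mul_right]
    ring
  refine (mul_eq_zero.1 key).resolve_left (sub_ne_zero.2 fun h ↦ hp1 N ?_)
  rw [h, ← zpow_natCast p 2, ← zpow_natCast, ← zpow_mul]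
  push_cast
  rfl

/-- The partial fraction expansion of the reciprocal of the truncated theta product. -/
lemma tsum_thetaCoeff_div {p z : ℂ} (hp : p ≠ 0) (hz : z ≠ 0)
    (hp1 : ∀ j : ℕ, (p ^ 2) ^ (j + 1) ≠ 1) (hpz : ∀ n : ℤ, 1 - z * p ^ (2 * n) ≠ 0) (N : ℕ) :
    (∑' n, thetaCoeff p N n * (1 - z * p ^ (2 * n))⁻¹) *
      ((∏ k ∈ Finset.range (N + 1), (1 - z * (p ^ 2) ^ k)) *
        ∏ k ∈ Finset.range N, (1 - (p ^ 2) ^ (k + 1) / z)) = 1 := by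
  induction N with
  | zero =>
    rw [tsum_eq_single 0 fun n hn ↦ by rw [thetaCoeff_eq_zero p (by simpa using hn), zero_mul]]
    have h := hpz 0
    simp only [mul_zero, zpow_zero, mul_one] at h
    simp [thetaCoeff, recipPoch, h]
  | succ N ih =>
    rw [Finset.prod_range_succ (fun k ↦ 1 - z * (p ^ 2) ^ k) (N + 1),
      Finset.prod_range_succ (fun k ↦ 1 - (p ^ 2) ^ (k + 1) / z) N]
    set y : ℂ := (p ^ 2) ^ (N + 1) with hy
    have hterm (n : ℤ) : thetaCoeff p (N + 1) n * (1 - z * p ^ (2 * n))⁻¹ *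
        ((1 - z * y) * (1 - y / z)) = thetaCoeff p N n * (1 - z * p ^ (2 * n))⁻¹ +
          (thetaCoeff p (N + 1) n * (-y / z) + thetaCoeff p (N + 1) n * p ^ (-2 * n) * y) := by
      have hT : thetaCoeff p N n = thetaCoeff p (N + 1) n *
          ((1 - y * p ^ (-2 * n)) * (1 - y * p ^ (2 * n))) := by
        have h1 : (N : ℤ) - n = N + 1 - n - 1 := by ring
        have h2 : (N : ℤ) + n = N + 1 + n - 1 := by ring
        have h3 : (p ^ 2) ^ ((N : ℤ) + 1 - n) = y * p ^ (-2 * n) := by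
          rw [hy, ← zpow_natCast p 2, ← zpow_natCast, ← zpow_mul, ← zpow_mul, ← zpow_add₀ hp]
          congr 1; push_cast; ring
        have h4 : (p ^ 2) ^ ((N : ℤ) + 1 + n) = y * p ^ (2 * n) := by
          rw [hy, ← zpow_natCast p 2, ← zpow_natCast, ← zpow_mul, ← zpow_mul, ← zpow_add₀ hp]
          congr 1; push_cast; ring
        rw [thetaCoeff, thetaCoeff, h1, h2, recipPoch_sub_one hp1, recipPoch_sub_one hp1, h3, h4]
        ring
      rw [hT]
      have hw : p ^ (-2 * n) = (p ^ (2 * n))⁻¹ := by rw [← zpow_neg]; congr 1; ring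
      have hw0 : p ^ (2 * n) ≠ 0 := zpow_ne_zero _ hp
      have := hpz n
      rw [hw]
      generalize p ^ (2 * n) = w at *
      field_simp
      ring
    have hsum : (∑' n, thetaCoeff p (N + 1) n * (1 - z * p ^ (2 * n))⁻¹) *
        ((1 - z * y) * (1 - y / z)) = ∑' n, thetaCoeff p N n * (1 - z * p ^ (2 * n))⁻¹ := by
      rw [← tsum_mul_right, tsum_congr hterm, (summable_thetaCoeff_mul p N _).tsum_add
        (((summable_thetaCoeff_mul p _ _)).add ((summable_thetaCoeff_mul p _ _).mul_right _)),
        (summable_thetaCoeff_mul p _ _).tsum_add ((summable_thetaCoeff_mul p _ _).mul_right _),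
        tsum_mul_right, tsum_mul_right, tsum_thetaCoeff_mul_zpow hp, tsum_thetaCoeff hp hp1]
      ring
    rw [← hsum] at ih
    push_cast
    linear_combination ih

lemma summable_norm_neg_mul_pow (a : ℂ) {x : ℂ} (hx : ‖x‖ < 1) :
    Summable fun k : ℕ ↦ ‖-(a * x ^ k)‖ := by
  simp only [norm_neg, norm_mul, norm_pow]
  exact (summable_geometric_of_lt_one (norm_nonneg x) hx).mul_left _

lemma tendsto_prod_poch (a : ℂ) {x : ℂ} (hx : ‖x‖ < 1) :
    Tendsto (fun N ↦ ∏ k ∈ Finset.range N, (1 - a * x ^ k)) atTop (𝓝 (poch a x)) := by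
  simpa only [poch, ← sub_eq_add_neg] using
    (multipliable_one_add_of_summable (summable_norm_neg_mul_pow a hx)).tendsto_prod_tprod_nat

lemma poch_ne_zero {a x : ℂ} (hx : ‖x‖ < 1) (ha : ∀ k : ℕ, 1 - a * x ^ k ≠ 0) : poch a x ≠ 0 := by
  simpa only [poch, ← sub_eq_add_neg] using tprod_one_add_ne_zero_of_summable
    (f := fun k ↦ -(a * x ^ k)) (by simpa only [← sub_eq_add_neg] using ha)
    (summable_norm_neg_mul_pow a hx)

lemma pow_succ_ne_one {x : ℂ} (hx : ‖x‖ < 1) (j : ℕ) : x ^ (j + 1) ≠ 1 := fun h ↦ by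
  have h' := pow_lt_one₀ (norm_nonneg x) hx j.succ_ne_zero
  rw [← norm_pow, Nat.succ_eq_add_one, h, norm_one] at h'
  exact lt_irrefl _ h'

lemma poch_self_ne_zero {x : ℂ} (hx : ‖x‖ < 1) : poch x x ≠ 0 :=
  poch_ne_zero hx fun k ↦ by
    rw [← pow_succ']
    exact sub_ne_zero.2 (pow_succ_ne_one hx k).symm

lemma tendsto_recipPoch_natCast {x : ℂ} (hx : ‖x‖ < 1) :
    Tendsto (fun k : ℕ ↦ recipPoch x k) atTop (𝓝 (poch x x)⁻¹) := by
  simp only [recipPoch_natCast, pow_succ']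
  exact (tendsto_prod_poch x hx).inv₀ (poch_self_ne_zero hx)

lemma tendsto_recipPoch {x : ℂ} (hx : ‖x‖ < 1) (n : ℤ) :
    Tendsto (fun N : ℕ ↦ recipPoch x (N + n)) atTop (𝓝 (poch x x)⁻¹) := by
  have h : Tendsto (fun N : ℕ ↦ ((N : ℤ) + n).toNat) atTop atTop :=
    tendsto_atTop.2 fun b ↦ (eventually_ge_atTop (b + n.natAbs)).mono fun N hN ↦ by lia
  refine ((tendsto_recipPoch_natCast hx).comp h).congr' ?_
  filter_upwards [eventually_ge_atTop n.natAbs] with N hN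
  rw [Function.comp_apply, Int.toNat_of_nonneg (by lia)]

lemma exists_norm_recipPoch_le {x : ℂ} (hx : ‖x‖ < 1) : ∃ C, ∀ k : ℤ, ‖recipPoch x k‖ ≤ C := by
  obtain ⟨C, hC⟩ := (Metric.isBounded_range_of_tendsto _
    (tendsto_recipPoch_natCast hx)).exists_norm_le
  refine ⟨C, fun k ↦ ?_⟩
  rcases lt_or_ge k 0 with hk | hk
  · rw [recipPoch_of_neg x hk, norm_zero]
    exact (norm_nonneg _).trans (hC _ ⟨0, rfl⟩)
  · lift k to ℕ using hk
    exact hC _ ⟨k, rfl⟩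

lemma exists_norm_inv_one_sub_le {x z : ℂ} (hx0 : x ≠ 0) (hx : ‖x‖ < 1) (hz : z ≠ 0) :
    ∃ C, ∀ n : ℤ, ‖(1 - z * x ^ n)⁻¹‖ ≤ C := by
  have h1 : Tendsto (fun k : ℕ ↦ (1 - z * x ^ k)⁻¹) atTop (𝓝 (1 - z * 0)⁻¹) :=
    (tendsto_const_nhds.sub ((tendsto_pow_atTop_nhds_zero_of_norm_lt_one hx).const_mul z)).inv₀
      (by simp)
  have h2 : Tendsto (fun k : ℕ ↦ x ^ k / (x ^ k - z)) atTop (𝓝 (0 / (0 - z))) :=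
    (tendsto_pow_atTop_nhds_zero_of_norm_lt_one hx).div
      ((tendsto_pow_atTop_nhds_zero_of_norm_lt_one hx).sub_const z) (by simpa using hz)
  obtain ⟨C, hC⟩ := (Metric.isBounded_range_of_tendsto _ h1).exists_norm_le
  obtain ⟨D, hD⟩ := (Metric.isBounded_range_of_tendsto _ h2).exists_norm_le
  refine ⟨max C D, fun n ↦ ?_⟩
  obtain ⟨k, rfl | rfl⟩ := n.eq_nat_or_neg
  · exact le_max_of_le_left (hC _ ⟨k, by simp⟩)
  · refine le_max_of_le_right (hD _ ⟨k, ?_⟩)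
    have hk : x ^ k ≠ 0 := pow_ne_zero _ hx0
    have h : 1 - z * x ^ (-(k : ℤ)) = (x ^ k - z) / x ^ k := by
      rw [zpow_neg, zpow_natCast]
      field_simp
    simp only [h, inv_div]

lemma summable_zpow_sq_add {r : ℝ} (hr0 : 0 < r) (hr : r < 1) :
    Summable fun n : ℤ ↦ r ^ (n ^ 2 + n) := by
  have hg := summable_geometric_of_lt_one hr0.le hr
  refine Summable.of_nat_of_neg ?_ ?_
  · refine hg.of_nonneg_of_le (fun k ↦ by positivity) fun k ↦ ?_
    rw [← zpow_natCast]
    exact zpow_le_zpow_right_of_le_one₀ hr0 hr.le (by nlinarith)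
  · refine (hg.mul_left r⁻¹).of_nonneg_of_le (fun k ↦ by positivity) fun k ↦ ?_
    rw [← zpow_natCast, ← zpow_neg_one, ← zpow_add₀ hr0.ne']
    exact zpow_le_zpow_right_of_le_one₀ hr0 hr.le (by nlinarith [sq_nonneg ((k : ℤ) - 1)])

lemma summable_norm_appell {p x z : ℂ} (hp0 : p ≠ 0) (hp : ‖p‖ < 1) (hx0 : x ≠ 0) (hx : ‖x‖ < 1)
    (hz : z ≠ 0) : Summable fun n : ℤ ↦ ‖(-1) ^ n * p ^ (n ^ 2 + n) * (1 - z * x ^ n)⁻¹‖ := by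
  obtain ⟨C, hC⟩ := exists_norm_inv_one_sub_le hx0 hx hz
  refine ((summable_zpow_sq_add (norm_pos_iff.2 hp0) hp).mul_right C).of_nonneg_of_le
    (fun n ↦ norm_nonneg _) fun n ↦ ?_
  rw [norm_mul, norm_mul, norm_zpow, norm_zpow, norm_neg, norm_one, one_zpow, one_mul]
  gcongr
  exact hC n

/-- The partial fraction expansion of the reciprocal of the theta product. -/
theorem tsum_appell_mul_poch {p z : ℂ} (hp0 : p ≠ 0) (hp : ‖p‖ < 1) (hz : z ≠ 0)
    (hpz : ∀ n : ℤ, 1 - z * p ^ (2 * n) ≠ 0) :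
    (∑' n : ℤ, (-1) ^ n * p ^ (n ^ 2 + n) * (1 - z * p ^ (2 * n))⁻¹) *
      (poch z (p ^ 2) * poch (p ^ 2 / z) (p ^ 2)) = poch (p ^ 2) (p ^ 2) ^ 2 := by
  have hx0 : p ^ 2 ≠ 0 := pow_ne_zero _ hp0
  have hx : ‖p ^ 2‖ < 1 := by
    rw [norm_pow]
    exact pow_lt_one₀ (norm_nonneg p) hp two_ne_zero
  have hzpow (n : ℤ) : (p ^ 2) ^ n = p ^ (2 * n) := by
    rw [← zpow_natCast p 2, ← zpow_mul, Nat.cast_ofNat]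
  have hsum : Summable fun n : ℤ ↦ ‖(-1) ^ n * p ^ (n ^ 2 + n) * (1 - z * p ^ (2 * n))⁻¹‖ := by
    simpa only [hzpow] using summable_norm_appell hp0 hp hx0 hx hz
  obtain ⟨C, hC⟩ := exists_norm_recipPoch_le hx
  have hC0 : 0 ≤ C := (norm_nonneg _).trans (hC 0)
  have h1 : Tendsto (fun N : ℕ ↦ ∑' n, thetaCoeff p N n * (1 - z * p ^ (2 * n))⁻¹) atTop
      (𝓝 (∑' n : ℤ, (-1) ^ n * p ^ (n ^ 2 + n) * (poch (p ^ 2) (p ^ 2))⁻¹ *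
        (poch (p ^ 2) (p ^ 2))⁻¹ * (1 - z * p ^ (2 * n))⁻¹)) := by
    refine tendsto_tsum_of_dominated_convergence (hsum.mul_left (C * C)) (fun n ↦ ?_)
      (Eventually.of_forall fun N n ↦ ?_)
    · refine Tendsto.mul_const _ ((Tendsto.const_mul _ ?_).mul (tendsto_recipPoch hx n))
      simpa only [sub_eq_add_neg] using tendsto_recipPoch hx (-n)
    · calc ‖thetaCoeff p N n * (1 - z * p ^ (2 * n))⁻¹‖
          = ‖recipPoch (p ^ 2) (N - n)‖ * ‖recipPoch (p ^ 2) (N + n)‖ *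
            ‖(-1) ^ n * p ^ (n ^ 2 + n) * (1 - z * p ^ (2 * n))⁻¹‖ := by
            simp only [thetaCoeff, norm_mul]
            ring
        _ ≤ C * C * ‖(-1) ^ n * p ^ (n ^ 2 + n) * (1 - z * p ^ (2 * n))⁻¹‖ := by
            gcongr <;> exact hC _
  have h2 : Tendsto (fun N ↦ ∏ k ∈ Finset.range N, (1 - (p ^ 2) ^ (k + 1) / z)) atTop
      (𝓝 (poch (p ^ 2 / z) (p ^ 2))) := by
    refine (tendsto_prod_poch _ hx).congr fun N ↦ Finset.prod_congr rfl fun k _ ↦ ?_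
    rw [pow_succ' (p ^ 2), div_mul_eq_mul_div]
  have h3 := h1.mul (((tendsto_prod_poch z hx).comp (tendsto_add_atTop_nat 1)).mul h2)
  have h4 := tendsto_nhds_unique h3 (tendsto_const_nhds.congr fun N ↦
    (tsum_thetaCoeff_div hp0 hz (pow_succ_ne_one hx) hpz N).symm)
  have h5 (n : ℤ) : (-1) ^ n * p ^ (n ^ 2 + n) * (poch (p ^ 2) (p ^ 2))⁻¹ *
      (poch (p ^ 2) (p ^ 2))⁻¹ * (1 - z * p ^ (2 * n))⁻¹ =
      (-1) ^ n * p ^ (n ^ 2 + n) * (1 - z * p ^ (2 * n))⁻¹ * (poch (p ^ 2) (p ^ 2) ^ 2)⁻¹ := by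
    ring
  rw [tsum_congr h5, tsum_mul_right] at h4
  have h6 := pow_ne_zero 2 (poch_self_ne_zero hx)
  rw [mul_right_comm] at h4
  exact (mul_inv_eq_one₀ h6).1 h4

lemma poch_eq_mul_mul (a : ℂ) {x : ℂ} (hx : ‖x‖ < 1) :
    poch a x = poch a (x ^ 3) * poch (a * x) (x ^ 3) * poch (a * x ^ 2) (x ^ 3) := by
  have hx3 : ‖x ^ 3‖ < 1 := by
    rw [norm_pow]
    exact pow_lt_one₀ (norm_nonneg x) hx three_ne_zero
  refine tendsto_nhds_unique ((tendsto_prod_poch a hx).comp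
    (tendsto_id.const_mul_atTop' (show 0 < 3 by simp))) ?_
  refine (((tendsto_prod_poch a hx3).mul (tendsto_prod_poch (a * x) hx3)).mul
    (tendsto_prod_poch (a * x ^ 2) hx3)).congr fun N ↦ ?_
  simp only [Function.comp_apply, id]
  induction N with
  | zero => simp
  | succ N ih =>
    simp only [mul_add_one, Finset.prod_range_succ, ← ih]
    ring

theorem stmt5 (q : ℂ) (hq0 : q ≠ 0) (hq : ‖q‖ < 1)
    (h : ∀ n : ℤ, q ^ (3 * n + 1) ≠ 1 ∧ q ^ (3 * n + 1) ≠ -1) :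
    (∑' n : ℤ, (-1 : ℂ) ^ n * q ^ (3 * n ^ 2 + 3 * n) / (1 + q ^ (3 * n + 1)))
      + (∑' n : ℤ, (-1 : ℂ) ^ n * q ^ (3 * n ^ 2 + 3 * n) / (1 - q ^ (3 * n + 1)))
      = 2 * (Jm 6 q) ^ 3 / Jm 2 q := by
  have norm_lt (k : ℕ) (hk : k ≠ 0) : ‖q ^ k‖ < 1 := by
    rw [norm_pow]
    exact pow_lt_one₀ (norm_nonneg q) hq hk
  have hp0 : q ^ 3 ≠ 0 := pow_ne_zero _ hq0
  have hp := norm_lt 3 three_ne_zero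
  have e1 (n : ℤ) : q ^ (3 * n ^ 2 + 3 * n) = (q ^ 3) ^ (n ^ 2 + n) := by
    rw [← zpow_natCast q 3, ← zpow_mul]; congr 1; push_cast; ring
  have e2 (n : ℤ) : q ^ (3 * n + 1) = q * (q ^ 3) ^ n := by
    rw [← zpow_natCast q 3, ← zpow_mul, zpow_add₀ hq0, zpow_one, mul_comm, Nat.cast_ofNat]
  have e3 (n : ℤ) : q ^ 2 * (q ^ 3) ^ (2 * n) = (q * (q ^ 3) ^ n) ^ 2 := by
    rw [mul_pow, mul_comm 2 n, zpow_mul]; rfl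
  have hs1 : Summable fun n : ℤ ↦
      (-1 : ℂ) ^ n * q ^ (3 * n ^ 2 + 3 * n) / (1 + q ^ (3 * n + 1)) := by
    refine (summable_norm_appell hp0 hp hp0 hp (neg_ne_zero.2 hq0)).of_norm.congr fun n ↦ ?_
    rw [e1, e2, neg_mul, sub_neg_eq_add, div_eq_mul_inv]
  have hs2 : Summable fun n : ℤ ↦
      (-1 : ℂ) ^ n * q ^ (3 * n ^ 2 + 3 * n) / (1 - q ^ (3 * n + 1)) := by
    refine (summable_norm_appell hp0 hp hp0 hp hq0).of_norm.congr fun n ↦ ?_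
    rw [e1, e2, div_eq_mul_inv]
  have hne (n : ℤ) : 1 - q ^ 2 * (q ^ 3) ^ (2 * n) ≠ 0 := by
    rw [e3, ← e2, ne_eq, sub_eq_zero, eq_comm, sq_eq_one_iff]
    exact not_or.2 (h n)
  have hterm (n : ℤ) : (-1 : ℂ) ^ n * q ^ (3 * n ^ 2 + 3 * n) / (1 + q ^ (3 * n + 1)) +
      (-1 : ℂ) ^ n * q ^ (3 * n ^ 2 + 3 * n) / (1 - q ^ (3 * n + 1)) =
      2 * ((-1) ^ n * (q ^ 3) ^ (n ^ 2 + n) * (1 - q ^ 2 * (q ^ 3) ^ (2 * n))⁻¹) := by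
    have h1 : 1 - q ^ (3 * n + 1) ≠ 0 := sub_ne_zero.2 (h n).1.symm
    have h2 : 1 + q ^ (3 * n + 1) ≠ 0 := fun h' ↦ (h n).2 (eq_neg_of_add_eq_zero_right h')
    have h3 := hne n
    rw [e3, ← e2] at h3 ⊢
    rw [← e1]
    field_simp
    ring
  rw [← hs1.tsum_add hs2, tsum_congr hterm, tsum_mul_left]
  have key := tsum_appell_mul_poch hp0 hp (pow_ne_zero 2 hq0) hne
  have hJ := poch_eq_mul_mul (q ^ 2) (norm_lt 2 two_ne_zero)
  have h4 : (q ^ 3) ^ 2 / q ^ 2 = q ^ 4 := by field_simp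
  have h6 : (q ^ 3) ^ 2 = q ^ 6 := by ring
  rw [h4, h6] at key
  rw [show (q ^ 2) ^ 3 = q ^ 6 by ring, show q ^ 2 * q ^ 2 = q ^ 4 by ring,
    show q ^ 2 * (q ^ 2) ^ 2 = q ^ 6 by ring] at hJ
  have hJ2 : Jm 2 q ≠ 0 := poch_self_ne_zero (norm_lt 2 two_ne_zero)
  rw [eq_div_iff hJ2]
  simp only [Jm]
  rw [hJ, pow_succ (poch _ _), ← key]
  ring
end

section
/- For |q|<1, the theta-function identity J₁₈³/J_{3,18}³ − 8q³·J₁₈³/J_{9,18}³ = J_{3,18}⁵ J₆⁴ / J₁₈⁹ holds. -/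
open scoped BigOperators

theorem multipliable_poch (a : ℂ) {q : ℂ} (hq : ‖q‖ < 1) :
    Multipliable fun n : ℕ => 1 - a * q ^ n := by
  simpa [sub_eq_add_neg] using Complex.multipliable_one_add_of_summable
    (((summable_geometric_of_norm_lt_one hq).mul_left a).neg)

theorem tendsto_poch (a : ℂ) {q : ℂ} (hq : ‖q‖ < 1) :
    Filter.Tendsto (fun n => ∏ k ∈ Finset.range n, (1 - a * q ^ k)) Filter.atTop
      (nhds (poch a q)) :=
  (multipliable_poch a hq).tendsto_prod_tprod_nat

theorem poch_ne_zero_s7 {a q : ℂ} (ha : ‖a‖ < 1) (hq : ‖q‖ < 1) : poch a q ≠ 0 := by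
  have h := tprod_one_add_ne_zero_of_summable (f := fun n : ℕ => -(a * q ^ n)) (fun n h0 => ?_)
    (((summable_geometric_of_norm_lt_one hq).mul_left a).neg.norm)
  · simpa [poch, sub_eq_add_neg] using h
  · have h1 : a * q ^ n = 1 := by linear_combination -h0
    have h2 : ‖a‖ * ‖q‖ ^ n = 1 := by rw [← norm_pow, ← norm_mul, h1, norm_one]
    have h3 : ‖q‖ ^ n ≤ 1 := pow_le_one₀ (norm_nonneg _) hq.le
    nlinarith [norm_nonneg a]

theorem poch_eq_mul_poch_sq (a : ℂ) {q : ℂ} (hq : ‖q‖ < 1) :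
    poch a q = poch a (q ^ 2) * poch (a * q) (q ^ 2) := by
  have hq2 : ‖q ^ 2‖ < 1 := by rw [norm_pow]; exact pow_lt_one₀ (norm_nonneg _) hq two_ne_zero
  have he : ∀ k, 1 - a * q ^ (2 * k) = 1 - a * (q ^ 2) ^ k := fun k => by ring
  have ho : ∀ k, 1 - a * q ^ (2 * k + 1) = 1 - a * q * (q ^ 2) ^ k := fun k => by ring
  rw [poch, ← tprod_even_mul_odd (f := fun n => 1 - a * q ^ n)]
  · simp only [he, ho, poch]
  · simpa only [he] using multipliable_poch a hq2
  · simpa only [ho] using multipliable_poch (a * q) hq2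

theorem poch_eq_mul_poch_cube (a : ℂ) {q : ℂ} (hq : ‖q‖ < 1) :
    poch a q = poch a (q ^ 3) * poch (a * q) (q ^ 3) * poch (a * q ^ 2) (q ^ 3) := by
  have hq3 : ‖q ^ 3‖ < 1 := by rw [norm_pow]; exact pow_lt_one₀ (norm_nonneg _) hq three_ne_zero
  refine tendsto_nhds_unique ((tendsto_poch a hq).comp
    (Filter.tendsto_id.const_mul_atTop' (r := 3) (by norm_num))) ?_
  refine (((tendsto_poch a hq3).mul (tendsto_poch (a * q) hq3)).mul
    (tendsto_poch (a * q ^ 2) hq3)).congr fun n => ?_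
  induction n with
  | zero => simp
  | succ n ih =>
    simp only [Function.comp_apply, id_eq, mul_add_one, Finset.prod_range_succ] at ih ⊢
    rw [← ih]
    ring

theorem poch_neg_mul_poch (a : ℂ) {q : ℂ} (hq : ‖q‖ < 1) :
    poch (-a) q * poch a q = poch (a ^ 2) (q ^ 2) := by
  rw [poch, poch, ← (multipliable_poch (-a) hq).tprod_mul (multipliable_poch a hq), poch]
  congr 1
  ext n
  ring

theorem poch_eq_one_sub_mul (a : ℂ) {q : ℂ} (hq : ‖q‖ < 1) :
    poch a q = (1 - a) * poch (a * q) q := by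
  have h : ∀ n : ℕ, 1 - a * q ^ (n + 1) = 1 - a * q * q ^ n := fun n => by ring
  rw [poch, tprod_eq_zero_mul']
  · simp only [h, poch, pow_zero, mul_one]
  · simpa only [h] using multipliable_poch (a * q) hq

/-- The Gaussian binomial coefficient, defined through its Pascal recursion. -/
noncomputable def gaussBinom (p : ℂ) : ℕ → ℕ → ℂ
  | _, 0 => 1
  | 0, _ + 1 => 0
  | n + 1, k + 1 => gaussBinom p n k + p ^ (k + 1) * gaussBinom p n (k + 1)

theorem gaussBinom_zero_right (p : ℂ) (n : ℕ) : gaussBinom p n 0 = 1 := by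
  cases n <;> simp [gaussBinom]

theorem gaussBinom_eq_zero (p : ℂ) {n k : ℕ} (h : n < k) : gaussBinom p n k = 0 := by
  induction n generalizing k with
  | zero => obtain ⟨k, rfl⟩ := Nat.exists_eq_succ_of_ne_zero (Nat.ne_of_gt h); simp [gaussBinom]
  | succ n ih =>
    obtain ⟨k, rfl⟩ := Nat.exists_eq_succ_of_ne_zero (show k ≠ 0 by omega)
    simp [gaussBinom, ih (show n < k by omega), ih (show n < k + 1 by omega)]

theorem gaussBinom_self (p : ℂ) (n : ℕ) : gaussBinom p n n = 1 := by
  induction n with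
  | zero => simp [gaussBinom]
  | succ n ih => simp [gaussBinom, ih, gaussBinom_eq_zero p (Nat.lt_succ_self n)]

theorem gaussBinom_add_mul (p : ℂ) (i k : ℕ) :
    gaussBinom p (i + k) i * (∏ l ∈ Finset.range i, (1 - p * p ^ l))
      * (∏ l ∈ Finset.range k, (1 - p * p ^ l)) = ∏ l ∈ Finset.range (i + k), (1 - p * p ^ l) := by
  induction i generalizing k with
  | zero => simp [gaussBinom_zero_right]
  | succ i ih =>
    induction k with
    | zero => simp [gaussBinom_self]
    | succ k ihk =>
      have h1 := ih (k + 1)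
      rw [show i + 1 + k = i + (k + 1) by omega] at ihk
      rw [show i + 1 + (k + 1) = i + (k + 1) + 1 by omega, gaussBinom, Finset.prod_range_succ _ i,
        Finset.prod_range_succ _ (i + (k + 1))]
      rw [Finset.prod_range_succ _ i] at ihk
      rw [Finset.prod_range_succ _ k] at h1 ⊢
      linear_combination (1 - p * p ^ i) * h1 + p ^ (i + 1) * (1 - p * p ^ k) * ihk

/-- The finite `q`-binomial theorem. -/
theorem prod_one_add_eq_sum_gaussBinom (p y : ℂ) (n : ℕ) :
    ∏ k ∈ Finset.range n, (1 + y * p ^ k)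
      = ∑ i ∈ Finset.range (n + 1), gaussBinom p n i * p ^ (i.choose 2) * y ^ i := by
  induction n generalizing y with
  | zero => simp [gaussBinom]
  | succ n ih =>
    have h : ∀ k, 1 + y * p ^ (k + 1) = 1 + (y * p) * p ^ k := fun k => by ring
    have hc : ∀ i : ℕ, (i + 1).choose 2 = i + i.choose 2 := fun i => by
      rw [Nat.choose_succ_succ' i 1, Nat.choose_one_right]
    rw [Finset.prod_range_succ', Finset.sum_range_succ']
    simp only [h, ih, gaussBinom, add_mul, Finset.sum_add_distrib]
    have e1 : ∑ i ∈ Finset.range (n + 1), gaussBinom p n i * p ^ (i.choose 2) * (y * p) ^ i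
        = ∑ i ∈ Finset.range (n + 1),
            p ^ (i + 1) * gaussBinom p n (i + 1) * p ^ ((i + 1).choose 2) * y ^ (i + 1) + 1 := by
      rw [Finset.sum_range_succ', Finset.sum_range_succ _ n, gaussBinom_eq_zero p (Nat.lt_succ_self n)]
      simp only [gaussBinom_zero_right]
      simp only [mul_zero, zero_mul, add_zero, Nat.choose_zero_succ, pow_zero, mul_one]
      congr 1
      exact Finset.sum_congr rfl fun i _ => by ring
    have e2 : ∑ i ∈ Finset.range (n + 1),
          gaussBinom p n i * p ^ ((i + 1).choose 2) * y ^ (i + 1)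
        = y * ∑ i ∈ Finset.range (n + 1), gaussBinom p n i * p ^ (i.choose 2) * (y * p) ^ i := by
      rw [Finset.mul_sum]
      exact Finset.sum_congr rfl fun i _ => by rw [hc]; ring
    rw [e2]
    simp only [Nat.choose_zero_succ, pow_zero, mul_one]
    linear_combination e1

theorem prod_one_add_inv_pow {r z : ℂ} (hr : r ≠ 0) (hz : z ≠ 0) (n : ℕ) :
    ∏ k ∈ Finset.range n, (1 + z * r⁻¹ ^ (2 * k + 1))
      = z ^ n * r⁻¹ ^ (n ^ 2) * ∏ k ∈ Finset.range n, (1 + z⁻¹ * r ^ (2 * k + 1)) := by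
  induction n with
  | zero => simp
  | succ n ih =>
    have h : 1 + z * r⁻¹ ^ (2 * n + 1)
        = z * r⁻¹ ^ (2 * n + 1) * (1 + z⁻¹ * r ^ (2 * n + 1)) := by
      rw [inv_pow]
      field_simp
      ring
    rw [Finset.prod_range_succ, Finset.prod_range_succ, ih, h]
    ring

/-- The finite form of the Jacobi triple product. -/
theorem prod_eq_sum_gaussBinom {r z : ℂ} (hr : r ≠ 0) (hz : z ≠ 0) (n : ℕ) :
    (∏ k ∈ Finset.range n, (1 + z * r ^ (2 * k + 1)))
        * ∏ k ∈ Finset.range n, (1 + z⁻¹ * r ^ (2 * k + 1))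
      = ∑ i ∈ Finset.range (2 * n + 1),
          gaussBinom (r ^ 2) (2 * n) i * (z ^ ((i : ℤ) - n) * r ^ (((i : ℤ) - n) ^ 2)) := by
  have h := prod_one_add_eq_sum_gaussBinom (r ^ 2) (z * (r * r⁻¹ ^ (2 * n))) (2 * n)
  rw [two_mul n, Finset.prod_range_add, ← Finset.prod_range_reflect, ← two_mul n] at h
  have h1 : ∀ k ∈ Finset.range n, 1 + z * (r * r⁻¹ ^ (2 * n)) * (r ^ 2) ^ (n - 1 - k)
      = 1 + z * r⁻¹ ^ (2 * k + 1) := fun k hk => by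
    obtain ⟨m, rfl⟩ : ∃ m, n = k + m + 1 := ⟨n - k - 1, by have := Finset.mem_range.1 hk; omega⟩
    rw [show k + m + 1 - 1 - k = m by omega, inv_pow, inv_pow]
    field_simp
    ring
  have h2 : ∀ k ∈ Finset.range n, 1 + z * (r * r⁻¹ ^ (2 * n)) * (r ^ 2) ^ (n + k)
      = 1 + z * r ^ (2 * k + 1) := fun k _ => by
    rw [inv_pow]
    field_simp
    ring
  rw [Finset.prod_congr rfl h1, Finset.prod_congr rfl h2, prod_one_add_inv_pow hr hz] at h
  have hc : z ^ n * r⁻¹ ^ (n ^ 2) ≠ 0 := by positivity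
  refine mul_left_cancel₀ hc ?_
  rw [Finset.mul_sum]
  refine Eq.trans ?_ (h.trans (Finset.sum_congr rfl fun i _ => ?_))
  · ring
  · have e : (r ^ 2) ^ i.choose 2 * r ^ i = r ^ (i ^ 2) := by
      rw [← pow_mul, ← pow_add, Nat.choose_two_right,
        Nat.mul_div_cancel' (Nat.even_mul_pred_self i).two_dvd]
      congr 1
      cases i with
      | zero => rfl
      | succ i => simp; ring
    have e1 : z ^ ((i : ℤ) - n) = z ^ i * (z ^ n)⁻¹ := by
      rw [zpow_sub₀ hz]; simp [div_eq_mul_inv]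
    have e2 : r ^ (((i : ℤ) - n) ^ 2) = r ^ (i ^ 2) * r ^ (n ^ 2) * (r ^ (2 * n * i))⁻¹ := by
      rw [show ((i : ℤ) - n) ^ 2 = ((i ^ 2 : ℕ) : ℤ) + ((n ^ 2 : ℕ) : ℤ) - ((2 * n * i : ℕ) : ℤ) by
        push_cast; ring, zpow_sub₀ hr, zpow_add₀ hr]
      simp only [zpow_natCast, div_eq_mul_inv]
    rw [e1, e2, ← e]
    simp only [mul_pow, inv_pow, ← pow_mul]
    field_simp

theorem prod_one_sub_ne_zero {p : ℂ} (hp : ‖p‖ < 1) (m : ℕ) :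
    ∏ l ∈ Finset.range m, (1 - p * p ^ l) ≠ 0 :=
  Finset.prod_ne_zero_iff.2 fun l _ h0 => by
    have h1 : p ^ (l + 1) = 1 := by linear_combination -h0
    have h2 : ‖p‖ ^ (l + 1) = 1 := by rw [← norm_pow, h1, norm_one]
    exact (pow_lt_one₀ (norm_nonneg _) hp (Nat.succ_ne_zero l)).ne h2

theorem tendsto_gaussBinom {p : ℂ} (hp : ‖p‖ < 1) (j : ℤ) :
    Filter.Tendsto (fun n : ℕ => gaussBinom p (2 * n) (j + n).toNat) Filter.atTop
      (nhds (poch p p)⁻¹) := by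
  have hP := tendsto_poch p hp
  have hL := poch_ne_zero_s7 hp hp
  have t2 : Filter.Tendsto (fun n : ℕ => 2 * n) Filter.atTop Filter.atTop :=
    Filter.tendsto_atTop_mono (fun n => show n ≤ 2 * n by omega) Filter.tendsto_id
  have ti : ∀ l : ℤ, Filter.Tendsto (fun n : ℕ => (l + n).toNat) Filter.atTop Filter.atTop :=
    fun l => Filter.tendsto_atTop.2 fun b =>
      (Filter.eventually_ge_atTop (b + l.natAbs)).mono fun n hn => by omega
  have h := ((hP.comp t2).mul (((hP.comp (ti j)).inv₀ hL).mul ((hP.comp (ti (-j))).inv₀ hL)))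
  rw [mul_inv_cancel_left₀ hL] at h
  refine h.congr' ((Filter.eventually_ge_atTop j.natAbs).mono fun n hn => ?_)
  have hne := prod_one_sub_ne_zero hp
  have hm := gaussBinom_add_mul p (j + n).toNat (-j + n).toNat
  rw [show (j + n).toNat + (-j + n).toNat = 2 * n by omega] at hm
  simp only [Function.comp_apply]
  rw [← hm]
  field_simp [hne]

theorem exists_norm_gaussBinom_le {p : ℂ} (hp : ‖p‖ < 1) :
    ∃ C : ℝ, ∀ n k, ‖gaussBinom p n k‖ ≤ C := by
  have hP := tendsto_poch p hp
  obtain ⟨A, hA⟩ := hP.norm.bddAbove_range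
  obtain ⟨B, hB⟩ := (hP.inv₀ (poch_ne_zero_s7 hp hp)).norm.bddAbove_range
  have hA' : ∀ n, ‖∏ l ∈ Finset.range n, (1 - p * p ^ l)‖ ≤ A := fun n => hA ⟨n, rfl⟩
  have hB' : ∀ n, ‖(∏ l ∈ Finset.range n, (1 - p * p ^ l))⁻¹‖ ≤ B := fun n => hB ⟨n, rfl⟩
  have hA0 : 0 ≤ A := (norm_nonneg _).trans (hA' 0)
  have hB0 : 0 ≤ B := (norm_nonneg _).trans (hB' 0)
  refine ⟨A * (B * B), fun n k => ?_⟩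
  rcases lt_or_ge n k with h | h
  · rw [gaussBinom_eq_zero p h, norm_zero]
    positivity
  · obtain ⟨m, rfl⟩ := Nat.exists_eq_add_of_le h
    have hne := prod_one_sub_ne_zero hp
    have hm : gaussBinom p (k + m) k = (∏ l ∈ Finset.range (k + m), (1 - p * p ^ l))
        * ((∏ l ∈ Finset.range k, (1 - p * p ^ l))⁻¹
          * (∏ l ∈ Finset.range m, (1 - p * p ^ l))⁻¹) := by
      rw [← gaussBinom_add_mul p k m]
      field_simp [hne]
    rw [hm, norm_mul, norm_mul]
    exact mul_le_mul (hA' _) (mul_le_mul (hB' _) (hB' _) (norm_nonneg _) hB0) (by positivity) hA0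

/-- The Jacobi triple product identity. -/
theorem poch_mul_poch_mul_poch_eq_tsum {r z : ℂ} (hr : r ≠ 0) (hr1 : ‖r‖ < 1) (hz : z ≠ 0)
    (hs : Summable fun j : ℤ => ‖z ^ j * r ^ (j ^ 2)‖) :
    poch (-(z * r)) (r ^ 2) * poch (-(z⁻¹ * r)) (r ^ 2) * poch (r ^ 2) (r ^ 2)
      = ∑' j : ℤ, z ^ j * r ^ (j ^ 2) := by
  have hp : ‖r ^ 2‖ < 1 := by rw [norm_pow]; exact pow_lt_one₀ (norm_nonneg _) hr1 two_ne_zero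
  obtain ⟨C, hC⟩ := exists_norm_gaussBinom_le hp
  have hC0 : 0 ≤ C := (norm_nonneg _).trans (hC 0 0)
  let F : ℕ → ℤ → ℂ := fun n j => if -(n : ℤ) ≤ j then
    gaussBinom (r ^ 2) (2 * n) (j + n).toNat * (z ^ j * r ^ (j ^ 2)) else 0
  have hF : ∀ n, ∑' j, F n j = (∏ k ∈ Finset.range n, (1 - -(z * r) * (r ^ 2) ^ k))
      * ∏ k ∈ Finset.range n, (1 - -(z⁻¹ * r) * (r ^ 2) ^ k) := fun n => by
    have hinj : Function.Injective fun i : ℕ => (i : ℤ) - n := fun a b h => by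
      simpa using h
    have hl : ∀ w : ℂ, ∀ k : ℕ, 1 - -(w * r) * (r ^ 2) ^ k = 1 + w * r ^ (2 * k + 1) :=
      fun w k => by ring
    simp only [hl]
    rw [prod_eq_sum_gaussBinom hr hz, ← hinj.tsum_eq, tsum_eq_sum (s := Finset.range (2 * n + 1))]
    · exact Finset.sum_congr rfl fun i _ => by simp [F]
    · intro i hi
      have : 2 * n < i := by simpa using hi
      simp [F, gaussBinom_eq_zero (r ^ 2) this]
    · intro j hj
      by_cases h : -(n : ℤ) ≤ j
      · exact ⟨(j + n).toNat, by simp only; omega⟩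
      · simp [F, h] at hj
  have hlim : Filter.Tendsto (fun n => ∑' j, F n j) Filter.atTop
      (nhds (∑' j : ℤ, (poch (r ^ 2) (r ^ 2))⁻¹ * (z ^ j * r ^ (j ^ 2)))) := by
    refine tendsto_tsum_of_dominated_convergence (hs.mul_left C) (fun j => ?_)
      (Filter.Eventually.of_forall fun n j => ?_)
    · refine ((tendsto_gaussBinom hp j).mul_const _).congr'
        ((Filter.eventually_ge_atTop j.natAbs).mono fun n hn => ?_)
      simp only [F]
      rw [if_pos (by omega)]
    · simp only [F]
      split_ifs
      · rw [norm_mul]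
        exact mul_le_mul_of_nonneg_right (hC _ _) (norm_nonneg _)
      · rw [norm_zero]
        positivity
  have h := tendsto_nhds_unique (hlim.congr hF) ((tendsto_poch _ hp).mul (tendsto_poch _ hp))
  rw [← h, tsum_mul_left]
  field_simp [poch_ne_zero_s7 hp hp]

/-- The theta series `∑ δ ^ j * s ^ (A * j ^ 2 + B * j)`. -/
noncomputable def thetaSum (δ s : ℂ) (A B : ℤ) : ℂ := ∑' j : ℤ, δ ^ j * s ^ (A * j ^ 2 + B * j)

theorem summable_thetaSum {δ s : ℂ} (hδ : ‖δ‖ = 1) (hs0 : s ≠ 0) (hs : ‖s‖ < 1) {A : ℤ}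
    (hA : 1 ≤ A) (B : ℤ) : Summable fun j : ℤ => ‖δ ^ j * s ^ (A * j ^ 2 + B * j)‖ := by
  have hs' : 0 < ‖s‖ := norm_pos_iff.2 hs0
  have hg : Summable fun j : ℤ => ‖s‖ ^ j.natAbs := by
    have := summable_geometric_of_lt_one (norm_nonneg s) hs
    exact Summable.of_nat_of_neg (by simpa using this) (by simpa using this)
  refine (hg.mul_left (‖s‖ ^ (-(|B| + 1) ^ 2))).of_nonneg_of_le (fun _ => norm_nonneg _)
    fun j => ?_
  rw [norm_mul, norm_zpow, norm_zpow, hδ, one_zpow, one_mul, ← zpow_natCast,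
    ← zpow_add₀ hs'.ne', Int.natCast_natAbs]
  refine zpow_le_zpow_right_of_le_one₀ hs' hs.le ?_
  have h1 : -(|B| * |j|) ≤ B * j := by rw [← abs_mul]; exact neg_abs_le _
  have h2 : |j| ^ 2 = j ^ 2 := sq_abs j
  nlinarith [abs_nonneg B, abs_nonneg j, sq_nonneg (2 * |j| - (|B| + 1)), sq_nonneg (|B| + 1)]

theorem thetaSum_neg (s : ℂ) (A B : ℤ) : thetaSum 1 s A (-B) = thetaSum 1 s A B := by
  rw [thetaSum, ← (Equiv.neg ℤ).tsum_eq]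
  simp [thetaSum]

/-- Pairs of integers split according to the parity of their sum. -/
theorem bijective_sum_diff : Function.Bijective
    (Sum.elim (fun x : ℤ × ℤ => (x.1 + x.2, x.1 - x.2))
      (fun x : ℤ × ℤ => (x.1 + x.2 + 1, x.1 - x.2))) := by
  constructor
  · rintro (⟨a, b⟩ | ⟨a, b⟩) (⟨c, d⟩ | ⟨c, d⟩) h <;>
      simp only [Sum.elim_inl, Sum.elim_inr, Prod.mk.injEq] at h <;>
      simp <;> omega
  · rintro ⟨m, n⟩
    rcases Int.even_or_odd' (m + n) with ⟨k, hk | hk⟩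
    · exact ⟨Sum.inl (k, m - k), by simp only [Sum.elim_inl, Prod.mk.injEq]; omega⟩
    · exact ⟨Sum.inr (k, m - 1 - k), by simp only [Sum.elim_inr, Prod.mk.injEq]; omega⟩

theorem thetaSum_mul_thetaSum {δ s : ℂ} (hδ : δ ^ 2 = 1) (hs0 : s ≠ 0) (hs : ‖s‖ < 1) {A : ℤ}
    (hA : 1 ≤ A) (B C : ℤ) :
    thetaSum δ s A B * thetaSum δ s A C
      = thetaSum 1 s (2 * A) (B + C) * thetaSum 1 s (2 * A) (B - C)
        + δ * s ^ (A + B) * (thetaSum 1 s (2 * A) (2 * A + B + C)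
          * thetaSum 1 s (2 * A) (2 * A + B - C)) := by
  have hδ0 : δ ≠ 0 := fun h => by simp [h] at hδ
  have hδn : ‖δ‖ = 1 := by
    have : ‖δ‖ ^ 2 = 1 := by rw [← norm_pow, hδ, norm_one]
    exact (pow_eq_one_iff_of_nonneg (norm_nonneg δ) two_ne_zero).1 this
  have hδz : ∀ a : ℤ, δ ^ (2 * a) = 1 := fun a => by
    rw [zpow_mul, show (δ ^ (2 : ℤ)) = 1 by exact_mod_cast hδ, one_zpow]
  have hS := fun D => summable_thetaSum hδn hs0 hs hA D
  have hT := fun D => summable_thetaSum (norm_one (α := ℂ)) hs0 hs (show 1 ≤ 2 * A by omega) D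
  have hprod := summable_mul_of_summable_norm (hS B) (hS C)
  simp only [thetaSum]
  rw [tsum_mul_tsum_of_summable_norm (hS B) (hS C), tsum_mul_tsum_of_summable_norm (hT _) (hT _),
    tsum_mul_tsum_of_summable_norm (hT _) (hT _), ← tsum_mul_left,
    ← (Equiv.ofBijective _ bijective_sum_diff).tsum_eq]
  have e1 : ∀ a b : ℤ, δ ^ (a + b) * s ^ (A * (a + b) ^ 2 + B * (a + b))
      * (δ ^ (a - b) * s ^ (A * (a - b) ^ 2 + C * (a - b)))
      = 1 ^ a * s ^ (2 * A * a ^ 2 + (B + C) * a)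
        * (1 ^ b * s ^ (2 * A * b ^ 2 + (B - C) * b)) := fun a b => by
    rw [mul_mul_mul_comm, ← zpow_add₀ hδ0, ← zpow_add₀ hs0, one_zpow, one_zpow, one_mul, one_mul,
      ← zpow_add₀ hs0, show a + b + (a - b) = 2 * a by ring, hδz, one_mul]
    congr 1
    ring
  have e2 : ∀ a b : ℤ, δ ^ (a + b + 1) * s ^ (A * (a + b + 1) ^ 2 + B * (a + b + 1))
      * (δ ^ (a - b) * s ^ (A * (a - b) ^ 2 + C * (a - b)))
      = δ * s ^ (A + B) * (1 ^ a * s ^ (2 * A * a ^ 2 + (2 * A + B + C) * a)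
        * (1 ^ b * s ^ (2 * A * b ^ 2 + (2 * A + B - C) * b))) := fun a b => by
    rw [mul_mul_mul_comm, ← zpow_add₀ hδ0, ← zpow_add₀ hs0, one_zpow, one_zpow, one_mul, one_mul,
      ← zpow_add₀ hs0, show a + b + 1 + (a - b) = 2 * a + 1 by ring, zpow_add₀ hδ0, hδz, one_mul,
      zpow_one, mul_assoc, ← zpow_add₀ hs0]
    congr 2
    ring
  have hsum := (Equiv.ofBijective _ bijective_sum_diff).summable_iff.2 hprod
  refine (Summable.tsum_sum (hsum.comp_injective Sum.inl_injective)
    (hsum.comp_injective Sum.inr_injective)).trans ?_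
  congr 1
  · exact tsum_congr fun x => e1 x.1 x.2
  · exact tsum_congr fun x => e2 x.1 x.2

theorem poch_mul_poch_mul_poch_eq_thetaSum {δ s : ℂ} (hδ : δ ^ 2 = 1) (hs0 : s ≠ 0)
    (hs : ‖s‖ < 1) {k m : ℕ} (hkm : k + m = 6) :
    poch (-(δ * s ^ k)) (s ^ 6) * poch (-(δ * s ^ m)) (s ^ 6) * poch (s ^ 6) (s ^ 6)
      = thetaSum δ s 3 (k - 3) := by
  have hδ0 : δ ≠ 0 := fun h => by simp [h] at hδ
  have hδn : ‖δ‖ = 1 := by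
    have : ‖δ‖ ^ 2 = 1 := by rw [← norm_pow, hδ, norm_one]
    exact (pow_eq_one_iff_of_nonneg (norm_nonneg δ) two_ne_zero).1 this
  have hδi : δ⁻¹ = δ := inv_eq_of_mul_eq_one_left (by rw [← sq, hδ])
  have hterm : ∀ j : ℤ, (δ * s ^ ((k : ℤ) - 3)) ^ j * (s ^ 3) ^ (j ^ 2)
      = δ ^ j * s ^ (3 * j ^ 2 + (k - 3) * j) := fun j => by
    rw [mul_zpow, ← zpow_mul, mul_assoc, ← zpow_natCast s 3, ← zpow_mul, ← zpow_add₀ hs0]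
    congr 2
    push_cast
    ring
  have h := poch_mul_poch_mul_poch_eq_tsum (r := s ^ 3) (z := δ * s ^ ((k : ℤ) - 3))
    (pow_ne_zero 3 hs0) (by rw [norm_pow]; exact pow_lt_one₀ (norm_nonneg _) hs three_ne_zero)
    (mul_ne_zero hδ0 (zpow_ne_zero _ hs0))
    (by simpa only [hterm] using summable_thetaSum hδn hs0 hs (by norm_num) _)
  have e1 : δ * s ^ ((k : ℤ) - 3) * s ^ 3 = δ * s ^ k := by
    rw [mul_assoc, ← zpow_natCast s 3, ← zpow_add₀ hs0, ← zpow_natCast s k]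
    congr 2
    push_cast
    ring
  have e2 : (δ * s ^ ((k : ℤ) - 3))⁻¹ * s ^ 3 = δ * s ^ m := by
    rw [mul_inv, hδi, ← zpow_neg, mul_assoc, ← zpow_natCast s 3, ← zpow_add₀ hs0,
      ← zpow_natCast s m]
    congr 2
    omega
  rw [e1, e2, ← pow_mul] at h
  simpa only [hterm, thetaSum] using h

theorem thetaSum_pow_four_sub {s : ℂ} (hs0 : s ≠ 0) (hs : ‖s‖ < 1) :
    thetaSum 1 s 3 (-1) ^ 4 - thetaSum (-1) s 3 (-1) ^ 4
      = s ^ 2 * thetaSum 1 s 3 (-3) ^ 3 * thetaSum 1 s 3 (-1) := by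
  have hX := thetaSum_mul_thetaSum (δ := 1) (by norm_num) hs0 hs (A := 3) (by norm_num) (-1) (-1)
  have hY := thetaSum_mul_thetaSum (δ := -1) (by norm_num) hs0 hs (A := 3) (by norm_num) (-1) (-1)
  have hZ := thetaSum_mul_thetaSum (δ := 1) (by norm_num) hs0 hs (A := 3) (by norm_num) (-3) (-3)
  have hZX := thetaSum_mul_thetaSum (δ := 1) (by norm_num) hs0 hs (A := 3) (by norm_num) (-3) (-1)
  norm_num [thetaSum_neg] at hX hY hZ hZX
  rw [thetaSum_neg s 3 1, thetaSum_neg s 3 3]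
  set T := thetaSum 1 s 6
  have hsum : thetaSum 1 s 3 1 ^ 2 + thetaSum (-1) s 3 (-1) ^ 2 = 2 * (T 2 * T 0) := by
    linear_combination hX + hY
  have hdiff : thetaSum 1 s 3 1 ^ 2 - thetaSum (-1) s 3 (-1) ^ 2
      = 2 * (s ^ 2 * (T 4 * T 6)) := by
    linear_combination hX - hY
  linear_combination (thetaSum 1 s 3 1 ^ 2 - thetaSum (-1) s 3 (-1) ^ 2) * hsum
    + 2 * (T 2 * T 0) * hdiff
    - s ^ 2 * thetaSum 1 s 3 3 * thetaSum 1 s 3 1 * hZ - s ^ 2 * 2 * (T 0 * T 6) * hZX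

theorem poch_pow_four_sub {Q : ℂ} (hQ0 : Q ≠ 0) (hQ : ‖Q‖ < 1) :
    (poch (-Q) (Q ^ 3) * poch (-Q ^ 2) (Q ^ 3)) ^ 4 - (poch Q (Q ^ 3) * poch (Q ^ 2) (Q ^ 3)) ^ 4
      = Q * (poch (-1) (Q ^ 3) * poch (-Q ^ 3) (Q ^ 3)) ^ 3
        * (poch (-Q) (Q ^ 3) * poch (-Q ^ 2) (Q ^ 3)) := by
  obtain ⟨s, rfl⟩ := IsAlgClosed.exists_pow_nat_eq Q two_pos
  have hs0 : s ≠ 0 := fun h => by simp [h] at hQ0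
  have hs : ‖s‖ < 1 := by
    rw [norm_pow] at hQ
    exact (pow_lt_one_iff_of_nonneg (norm_nonneg s) two_ne_zero).1 hQ
  have hp : ‖s ^ 6‖ < 1 := by rw [norm_pow]; exact pow_lt_one₀ (norm_nonneg _) hs (by norm_num)
  have h := thetaSum_pow_four_sub hs0 hs
  have hX := poch_mul_poch_mul_poch_eq_thetaSum (δ := 1) (by norm_num) hs0 hs
    (show 2 + 4 = 6 by rfl)
  have hY := poch_mul_poch_mul_poch_eq_thetaSum (δ := -1) (by norm_num) hs0 hs
    (show 2 + 4 = 6 by rfl)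
  have hZ := poch_mul_poch_mul_poch_eq_thetaSum (δ := 1) (by norm_num) hs0 hs
    (show 0 + 6 = 6 by rfl)
  norm_num at hX hY hZ
  rw [← hX, ← hY, ← hZ] at h
  refine mul_right_cancel₀ (pow_ne_zero 4 (poch_ne_zero_s7 hp hp)) ?_
  simp only [← pow_mul, Nat.reduceMul]
  linear_combination h

theorem stmt7 (q : ℂ) (hq0 : 0 < ‖q‖) (hq : ‖q‖ < 1) :
    (Jm 18 q) ^ 3 / (Jam 3 18 q) ^ 3 - 8 * q ^ 3 * (Jm 18 q) ^ 3 / (Jam 9 18 q) ^ 3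
      = (Jam 3 18 q) ^ 5 * (Jm 6 q) ^ 4 / (Jm 18 q) ^ 9 := by
  have hlt : ∀ {k : ℕ}, k ≠ 0 → ‖q ^ k‖ < 1 := fun hk => by
    rw [norm_pow]; exact pow_lt_one₀ (norm_nonneg _) hq hk
  have hne : ∀ {k m : ℕ}, k ≠ 0 → m ≠ 0 → poch (q ^ k) (q ^ m) ≠ 0 := fun hk hm =>
    poch_ne_zero_s7 (hlt hk) (hlt hm)
  have h := poch_pow_four_sub (Q := q ^ 3) (pow_ne_zero 3 (norm_pos_iff.1 hq0))
    (hlt three_ne_zero)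
  have hQ9 := hlt (show 9 ≠ 0 by norm_num)
  have d3 := poch_eq_mul_poch_sq (q ^ 3) hQ9
  have d6 := poch_eq_mul_poch_sq (q ^ 6) hQ9
  have d9 := poch_eq_mul_poch_sq (q ^ 9) hQ9
  have n3 := poch_neg_mul_poch (q ^ 3) hQ9
  have n6 := poch_neg_mul_poch (q ^ 6) hQ9
  have n9 := poch_neg_mul_poch (q ^ 9) hQ9
  have n0 := poch_eq_one_sub_mul (-1) hQ9
  have c6 := poch_eq_mul_poch_cube (q ^ 6) (hlt (show 6 ≠ 0 by norm_num))
  simp only [← pow_mul, ← pow_add, Nat.reduceMul, Nat.reduceAdd, neg_mul, one_mul, sub_neg_eq_add]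
    at h d3 d6 d9 n3 n6 n9 n0 c6
  have a3 := hne (k := 3) (m := 18) (by norm_num) (by norm_num)
  have a6 := hne (k := 6) (m := 18) (by norm_num) (by norm_num)
  have a9 := hne (k := 9) (m := 18) (by norm_num) (by norm_num)
  have a12 := hne (k := 12) (m := 18) (by norm_num) (by norm_num)
  have a15 := hne (k := 15) (m := 18) (by norm_num) (by norm_num)
  have a18 := hne (k := 18) (m := 18) (by norm_num) (by norm_num)
  simp only [Jm, Jam, Nat.reduceSub, c6]
  rw [d3] at n3
  rw [d6] at n6
  rw [d9] at n9
  rw [n0, d3, d6] at h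
  generalize poch (q ^ 3) (q ^ 18) = x3 at *
  generalize poch (q ^ 6) (q ^ 18) = x6 at *
  generalize poch (q ^ 9) (q ^ 18) = x9 at *
  generalize poch (q ^ 12) (q ^ 18) = x12 at *
  generalize poch (q ^ 15) (q ^ 18) = x15 at *
  generalize poch (q ^ 18) (q ^ 18) = x18 at *
  rw [← eq_div_iff (by positivity)] at n3 n6 n9
  rw [n3, n6, n9] at h
  field_simp at h ⊢
  linear_combination h
end
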